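/- arXiv:1610.07546 — 2 statements merged into one kernel-verified Lean document; each statement's English description precedes it below -/
import Mathlib

section
/- Let C be as in the 2-Calabi–Yau setup and let R = Rᵢ ⊕ R̄ be a basic cluster-tilting object of C with Rᵢ indecomposable. Then there exists an indecomposable object Rᵢ* of C, not isomorphic to Rᵢ, such that Rᵢ* ⊕ R̄ is a cluster-tilting object; moreover, any indecomposable object Y such that Y ⊕ R̄ is cluster-tilting is isomorphic either to Rᵢ or to Rᵢ*. (Existence and uniqueness of the mutation of a cluster-tilting object at an indecomposable summand.) -/
/-!
STATEMENT 13 (Iyama–Yoshino): In the 2-Calabi–Yau setup, let `R = Rᵢ ⊕ R̄` be a basic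
cluster-tilting object with `Rᵢ` indecomposable.  Then there is an indecomposable
object `Rᵢ*`, not isomorphic to `Rᵢ`, such that `Rᵢ* ⊕ R̄` is cluster-tilting, and
any indecomposable `Y` with `Y ⊕ R̄` cluster-tilting is isomorphic to `Rᵢ` or `Rᵢ*`.

Krull–Schmidt is encoded as idempotent completeness, which, together with
Hom-finiteness over the field `k`, is equivalent to the Krull–Schmidt property.
`R` basic is encoded as: no indecomposable object `Z` is such that `Z ⊞ Z` is a
direct summand of `R` (in a Krull–Schmidt category this says exactly that the
indecomposable summands of `R` are pairwise non-isomorphic).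
-/
open CategoryTheory Limits Pretriangulated

universe v u

section Setup

variable {C : Type u} [Category.{v} C] [Preadditive C] [HasZeroObject C]
  [HasShift C ℤ] [∀ n : ℤ, (shiftFunctor C n).Additive] [Pretriangulated C]
  [HasFiniteBiproducts C]

/-- `X` belongs to `add T`: it is a direct summand of a finite direct sum of copies
of `T`. -/
def InAdd (T X : C) : Prop :=
  ∃ (n : ℕ) (Y : C), Nonempty ((X ⊞ Y) ≅ ⨁ (fun _ : Fin n => T))

/-- `T` is rigid if `Hom(T, ΣT) = 0`. -/
def IsRigid (T : C) : Prop := ∀ f : T ⟶ T⟦(1 : ℤ)⟧, f = 0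

/-- `T` is cluster-tilting if it is rigid and every object `X` with `Hom(T, ΣX) = 0`
lies in `add T`. -/
def IsClusterTilting (T : C) : Prop :=
  IsRigid T ∧ ∀ X : C, (∀ f : T ⟶ X⟦(1 : ℤ)⟧, f = 0) → InAdd T X

end Setup

/-- A 2-Calabi–Yau structure: a bifunctorial isomorphism
`Hom(X, ΣY) ≅ (Hom(Y, ΣX))^*`. -/
structure TwoCYStructure (k : Type*) [Field k] (C : Type u) [Category.{v} C]
    [Preadditive C] [Linear k C] [HasShift C ℤ] where
  pair : ∀ X Y : C, (X ⟶ Y⟦(1 : ℤ)⟧) →ₗ[k] Module.Dual k (Y ⟶ X⟦(1 : ℤ)⟧)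
  bijective : ∀ X Y : C, Function.Bijective (pair X Y)
  nat_left : ∀ {X X' Y : C} (u : X' ⟶ X) (α : X ⟶ Y⟦(1 : ℤ)⟧) (β : Y ⟶ X'⟦(1 : ℤ)⟧),
    pair X' Y (u ≫ α) β = pair X Y α (β ≫ u⟦(1 : ℤ)⟧')
  nat_right : ∀ {X Y Y' : C} (v : Y ⟶ Y') (α : X ⟶ Y⟦(1 : ℤ)⟧) (β : Y' ⟶ X⟦(1 : ℤ)⟧),
    pair X Y' (α ≫ v⟦(1 : ℤ)⟧') β = pair X Y α (v ≫ β)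

section Defs

variable {C : Type u} [Category.{v} C] [Preadditive C] [HasZeroObject C]
  [HasShift C ℤ] [∀ n : ℤ, (shiftFunctor C n).Additive] [Pretriangulated C]
  [HasFiniteBiproducts C]

/-- An object is indecomposable if it is non-zero and any direct sum decomposition
has a zero summand. -/
def IsIndecomposable (X : C) : Prop :=
  ¬ Limits.IsZero X ∧ ∀ Y Z : C, Nonempty (X ≅ Y ⊞ Z) → Limits.IsZero Y ∨ Limits.IsZero Z

/-- An object is basic if no indecomposable object appears twice among its direct
summands. -/
def IsBasic (R : C) : Prop :=
  ∀ Z : C, IsIndecomposable Z → ¬ ∃ W : C, Nonempty (R ≅ (Z ⊞ Z) ⊞ W)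

end Defs

/-- An element of a finite-dimensional algebra without nontrivial idempotents is a unit, or
its difference with `1` is a unit. -/
lemma isUnit_or_isUnit_one_sub_of_idempotents {k A : Type*} [Field k] [Ring A] [Algebra k A]
    [FiniteDimensional k A] (hA : ∀ e : A, e * e = e → e = 0 ∨ e = 1) (a : A) :
    IsUnit a ∨ IsUnit (1 - a) := by
  have hp : minpoly k a ≠ 0 := minpoly.ne_zero (Algebra.IsIntegral.isIntegral a)
  obtain ⟨q, hq, hXq⟩ := Polynomial.exists_eq_pow_rootMultiplicity_mul_and_not_dvd _ hp 0
  rw [Polynomial.C_0, sub_zero] at hq hXq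
  set n := Polynomial.rootMultiplicity 0 (minpoly k a)
  have hcop : IsCoprime (Polynomial.X ^ (n + 1)) q :=
    ((Polynomial.irreducible_X.coprime_iff_not_dvd).2 hXq).pow_left
  obtain ⟨u, w, huw⟩ := hcop
  have hzero : a ^ (n + 1) * Polynomial.aeval a q = 0 := by
    have := minpoly.aeval k a
    rw [hq] at this
    rw [pow_succ', mul_assoc]
    simpa using congrArg (a * ·) this
  have hone : Polynomial.aeval a u * a ^ (n + 1) +
      Polynomial.aeval a w * Polynomial.aeval a q = 1 := by
    simpa using congrArg (Polynomial.aeval a) huw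
  have hcomm (p r : Polynomial k) : Commute (Polynomial.aeval a p) (Polynomial.aeval a r) :=
    (Commute.all p r).map (Polynomial.aeval a)
  have hmul : (Polynomial.aeval a u * a ^ (n + 1)) *
      (Polynomial.aeval a w * Polynomial.aeval a q) = 0 := by
    rw [(hcomm w q).eq, mul_assoc, ← mul_assoc (a ^ (n + 1)), hzero, zero_mul, mul_zero]
  have hidem : (Polynomial.aeval a u * a ^ (n + 1)) * (Polynomial.aeval a u * a ^ (n + 1)) =
      Polynomial.aeval a u * a ^ (n + 1) := by
    conv_rhs => rw [← mul_one (Polynomial.aeval a u * a ^ (n + 1)), ← hone, mul_add, hmul, add_zero]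
  rcases hA _ hidem with h | h
  · right
    have : a ^ (n + 1) = 0 := by
      rw [h, zero_add] at hone
      rw [← mul_one (a ^ (n + 1)), ← hone, (hcomm w q).eq, ← mul_assoc, hzero, zero_mul]
    exact IsNilpotent.isUnit_one_sub ⟨n + 1, this⟩
  · left
    have h' := h
    have hcomma : Commute (a ^ (n + 1)) (Polynomial.aeval a u) := by
      simpa using hcomm (Polynomial.X ^ (n + 1)) u
    rw [← hcomma.eq, pow_succ', mul_assoc] at h'
    rw [pow_succ, ← mul_assoc] at h
    exact ⟨⟨a, _, h', by rwa [left_inv_eq_right_inv h h'] at h⟩, rfl⟩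

section Splitting

variable {C : Type u} [Category.{v} C] [Preadditive C] [HasBinaryBiproducts C]

/-- In an idempotent complete category, retracts have complements. -/
lemma exists_complement [IsIdempotentComplete C] {X A : C} (i : X ⟶ A) (p : A ⟶ X)
    (h : i ≫ p = 𝟙 X) :
    ∃ (Y : C) (j : Y ⟶ A) (q : A ⟶ Y), j ≫ q = 𝟙 Y ∧ p ≫ i + q ≫ j = 𝟙 A ∧
      Nonempty ((X ⊞ Y) ≅ A) := by
  have hpi : (p ≫ i) ≫ (p ≫ i) = p ≫ i := by simp [reassoc_of% h]
  obtain ⟨Y, j, q, hjq, hqj⟩ := IsIdempotentComplete.idempotents_split A (𝟙 A - p ≫ i)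
    (by simp [reassoc_of% h])
  have hiq : i ≫ q = 0 := by
    rw [← Category.comp_id (i ≫ q), ← hjq, Category.assoc, reassoc_of% hqj]
    simp [reassoc_of% h]
  have hjp : j ≫ p = 0 := by
    rw [← Category.id_comp (j ≫ p), ← hjq, Category.assoc, reassoc_of% hqj]
    simp [h]
  refine ⟨Y, j, q, hjq, by rw [hqj]; abel, ⟨biprod.desc i j, biprod.lift p q, ?_, ?_⟩⟩
  · ext <;> simp [h, hjq, hiq, hjp]
  · simp [hqj]

end Splitting

section Through

variable {C : Type u} [Category.{v} C] [Preadditive C]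

/-- The morphisms `X ⟶ Y` which are sums of morphisms factoring through `T`. -/
def through (T X Y : C) : AddSubmonoid (X ⟶ Y) :=
  AddSubmonoid.closure {f | ∃ (a : X ⟶ T) (b : T ⟶ Y), a ≫ b = f}

lemma comp_mem_through {T X Y : C} (a : X ⟶ T) (b : T ⟶ Y) : a ≫ b ∈ through T X Y :=
  AddSubmonoid.subset_closure ⟨a, b, rfl⟩

lemma through_comp_left {T X' X Y : C} (g : X' ⟶ X) {f : X ⟶ Y} (hf : f ∈ through T X Y) :
    g ≫ f ∈ through T X' Y := by
  induction hf using AddSubmonoid.closure_induction with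
  | mem f hf =>
    obtain ⟨a, b, rfl⟩ := hf
    rw [← Category.assoc]
    exact comp_mem_through _ _
  | zero => simp
  | add f f' _ _ hf hf' =>
    rw [Preadditive.comp_add]
    exact add_mem hf hf'

lemma through_comp_right {T X Y Y' : C} {f : X ⟶ Y} (hf : f ∈ through T X Y) (g : Y ⟶ Y') :
    f ≫ g ∈ through T X Y' := by
  induction hf using AddSubmonoid.closure_induction with
  | mem f hf =>
    obtain ⟨a, b, rfl⟩ := hf
    rw [Category.assoc]
    exact comp_mem_through _ _
  | zero => simp
  | add f f' _ _ hf hf' =>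
    rw [Preadditive.add_comp]
    exact add_mem hf hf'

/-- If `A` lies in `add T`, morphisms through `A` are morphisms through `T`. -/
lemma through_trans {T A X Y : C} (hA : 𝟙 A ∈ through T A A) {f : X ⟶ Y}
    (hf : f ∈ through A X Y) : f ∈ through T X Y := by
  induction hf using AddSubmonoid.closure_induction with
  | mem f hf =>
    obtain ⟨a, b, rfl⟩ := hf
    simpa using through_comp_left a (through_comp_right hA b)
  | zero => simp
  | add f f' _ _ hf hf' => exact add_mem hf hf'

lemma id_mem_through_self (T : C) : 𝟙 T ∈ through T T T := by
  simpa using comp_mem_through (𝟙 T) (𝟙 T)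

lemma id_mem_through_of_retract {T X A : C} (i : X ⟶ A) (p : A ⟶ X) (h : i ≫ p = 𝟙 X)
    (hA : 𝟙 A ∈ through T A A) : 𝟙 X ∈ through T X X := by
  rw [← h]
  exact through_trans hA (comp_mem_through i p)

lemma exists_fin_sum_of_mem_through {T X Y : C} {f : X ⟶ Y} (hf : f ∈ through T X Y) :
    ∃ (n : ℕ) (a : Fin n → (X ⟶ T)) (b : Fin n → (T ⟶ Y)), ∑ j, a j ≫ b j = f := by
  induction hf using AddSubmonoid.closure_induction with
  | mem f hf =>
    obtain ⟨a, b, rfl⟩ := hf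
    exact ⟨1, fun _ => a, fun _ => b, by simp⟩
  | zero => exact ⟨0, Fin.elim0, Fin.elim0, by simp⟩
  | add f f' _ _ hf hf' =>
    obtain ⟨n, a, b, rfl⟩ := hf
    obtain ⟨n', a', b', rfl⟩ := hf'
    exact ⟨n + n', Fin.append a a', Fin.append b b', by simp [Fin.sum_univ_add]⟩

lemma id_biproduct_mem_through [HasFiniteBiproducts C] (T : C) (n : ℕ) :
    𝟙 (⨁ (fun _ : Fin n => T)) ∈ through T _ _ := by
  rw [← biproduct.total]
  exact sum_mem fun j _ => comp_mem_through _ _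

variable [HasBinaryBiproducts C]

lemma inl_mem_through (A B : C) : 𝟙 A ∈ through (A ⊞ B) A A := by
  rw [← biprod.inl_fst (X := A) (Y := B)]
  exact comp_mem_through _ _

lemma inr_mem_through (A B : C) : 𝟙 B ∈ through (A ⊞ B) B B := by
  rw [← biprod.inr_snd (X := A) (Y := B)]
  exact comp_mem_through _ _

lemma id_biprod_mem_through {T A B : C} (hA : 𝟙 A ∈ through T A A) (hB : 𝟙 B ∈ through T B B) :
    𝟙 (A ⊞ B) ∈ through T (A ⊞ B) (A ⊞ B) := by
  rw [← biprod.total]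
  exact add_mem (through_trans hA (comp_mem_through _ _)) (through_trans hB (comp_mem_through _ _))

/-- A morphism through `A ⊞ B` is a sum of morphisms through `A` and `B`. -/
lemma through_biprod_induction {A B X Y : C} {P : (X ⟶ Y) → Prop}
    (left : ∀ (a : X ⟶ A) (b : A ⟶ Y), P (a ≫ b)) (right : ∀ (a : X ⟶ B) (b : B ⟶ Y), P (a ≫ b))
    (zero : P 0) (add : ∀ f g, P f → P g → P (f + g)) {f : X ⟶ Y}
    (hf : f ∈ through (A ⊞ B) X Y) : P f := by
  induction hf using AddSubmonoid.closure_induction with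
  | mem f hf =>
    obtain ⟨a, b, rfl⟩ := hf
    have : a ≫ b = (a ≫ biprod.fst) ≫ (biprod.inl ≫ b) + (a ≫ biprod.snd) ≫ (biprod.inr ≫ b) := by
      conv_lhs => rw [← Category.id_comp b, ← biprod.total]
      simp only [Preadditive.add_comp, Preadditive.comp_add, Category.assoc]
    rw [this]
    exact add _ _ (left _ _) (right _ _)
  | zero => exact zero
  | add f f' _ _ hf hf' => exact add _ _ hf hf'

end Through

lemma finrank_end_lt_of_retract (k : Type*) [Field k]
    {C : Type u} [Category.{v} C] [Preadditive C] [Linear k C] {X A : C}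
    [FiniteDimensional k (A ⟶ A)]
    (i : X ⟶ A) (p : A ⟶ X) (h : i ≫ p = 𝟙 X) (h' : p ≫ i ≠ 𝟙 A) :
    Module.finrank k (X ⟶ X) < Module.finrank k (A ⟶ A) := by
  let φ : (X ⟶ X) →ₗ[k] (A ⟶ A) :=
    { toFun := fun u => p ≫ u ≫ i
      map_add' := fun u w => by simp
      map_smul' := fun c u => by simp }
  have hφ : Function.Injective φ := by
    intro u w huw
    have : i ≫ (p ≫ u ≫ i) ≫ p = i ≫ (p ≫ w ≫ i) ≫ p := congrArg (fun t => i ≫ t ≫ p) huw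
    simpa [h, reassoc_of% h] using this
  rw [← LinearMap.finrank_range_of_inj hφ]
  refine Submodule.finrank_lt fun htop => h' ?_
  obtain ⟨u, hu⟩ : 𝟙 A ∈ LinearMap.range φ := htop ▸ Submodule.mem_top
  have hu' : p ≫ u ≫ i = 𝟙 A := hu
  have : u = 𝟙 X := by
    have := congrArg (fun t => i ≫ t ≫ p) hu'
    simpa [h, reassoc_of% h] using this
  rwa [this, Category.id_comp] at hu'

section Local

variable {C : Type u} [Category.{v} C] [Preadditive C] [HasZeroObject C]
  [HasShift C ℤ] [∀ n : ℤ, (shiftFunctor C n).Additive] [Pretriangulated C]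

lemma IsIndecomposable.not_isIso_zero {X : C} (hX : IsIndecomposable X) :
    ¬ IsIso (0 : X ⟶ X) := fun h =>
  hX.1 ((IsZero.iff_id_eq_zero X).2 (by rw [← IsIso.hom_inv_id (0 : X ⟶ X), zero_comp]))

lemma InAdd.id_mem_through [HasFiniteBiproducts C] {T X : C} (h : InAdd T X) :
    𝟙 X ∈ through T X X := by
  obtain ⟨n, Y, ⟨e⟩⟩ := h
  exact id_mem_through_of_retract (biprod.inl ≫ e.hom) (e.inv ≫ biprod.fst) (by simp)
    (id_biproduct_mem_through T n)

/-- Induction along decompositions into indecomposable objects. -/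
lemma indecomposable_induction (k : Type*) [Field k] [Linear k C]
    (hfd : ∀ X Y : C, FiniteDimensional k (X ⟶ Y)) {P : C → Prop}
    (zero : ∀ X, IsZero X → P X) (indec : ∀ X, IsIndecomposable X → P X)
    (sum : ∀ X Y Z, (X ≅ Y ⊞ Z) → P Y → P Z → P X) (X : C) : P X := by
  by_cases hX : IsZero X
  · exact zero X hX
  by_cases hX' : IsIndecomposable X
  · exact indec X hX'
  have : ∃ Y Z : C, Nonempty (X ≅ Y ⊞ Z) ∧ ¬ IsZero Y ∧ ¬ IsZero Z := by
    by_contra! hcon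
    refine hX' ⟨hX, fun Y Z e => ?_⟩
    by_cases hY : IsZero Y
    · exact Or.inl hY
    · exact Or.inr (hcon Y Z e hY)
  obtain ⟨Y, Z, ⟨e⟩, hY, hZ⟩ := this
  have h₁ : Module.finrank k (Y ⟶ Y) < Module.finrank k (X ⟶ X) := by
    refine finrank_end_lt_of_retract k (biprod.inl ≫ e.inv) (e.hom ≫ biprod.fst) (by simp) ?_
    intro h
    refine hZ ((IsZero.iff_id_eq_zero Z).2 ?_)
    have := congrArg (fun t => biprod.inr ≫ e.inv ≫ t ≫ e.hom ≫ biprod.snd) h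
    simpa using this.symm
  have h₂ : Module.finrank k (Z ⟶ Z) < Module.finrank k (X ⟶ X) := by
    refine finrank_end_lt_of_retract k (biprod.inr ≫ e.inv) (e.hom ≫ biprod.snd) (by simp) ?_
    intro h
    refine hY ((IsZero.iff_id_eq_zero Y).2 ?_)
    have := congrArg (fun t => biprod.inl ≫ e.inv ≫ t ≫ e.hom ≫ biprod.fst) h
    simpa using this.symm
  exact sum X Y Z e (indecomposable_induction k hfd zero indec sum Y)
    (indecomposable_induction k hfd zero indec sum Z)
termination_by Module.finrank k (X ⟶ X)

/-- An object outside `add Q` has an indecomposable summand outside `add Q`. -/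
lemma exists_indecomposable_retract (k : Type*) [Field k] [Linear k C]
    (hfd : ∀ X Y : C, FiniteDimensional k (X ⟶ Y)) {Q : C}
    (M : C) (hM : 𝟙 M ∉ through Q M M) :
    ∃ (N : C) (i : N ⟶ M) (p : M ⟶ N), i ≫ p = 𝟙 N ∧ IsIndecomposable N ∧
      𝟙 N ∉ through Q N N := by
  induction M using indecomposable_induction k hfd with
  | zero M h => exact absurd (by rw [h.eq_of_src (𝟙 M) 0]; exact zero_mem _) hM
  | indec M h => exact ⟨M, 𝟙 M, 𝟙 M, by simp, h, hM⟩
  | sum X Y Z e hY hZ =>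
    by_cases h₁ : 𝟙 Y ∈ through Q Y Y
    · by_cases h₂ : 𝟙 Z ∈ through Q Z Z
      · exact absurd (id_mem_through_of_retract e.hom e.inv e.hom_inv_id
          (id_biprod_mem_through h₁ h₂)) hM
      · obtain ⟨N, i, p, hip, hN⟩ := hZ h₂
        exact ⟨N, i ≫ biprod.inr ≫ e.inv, e.hom ≫ biprod.snd ≫ p, by simpa using hip, hN⟩
    · obtain ⟨N, i, p, hip, hN⟩ := hY h₁
      exact ⟨N, i ≫ biprod.inl ≫ e.inv, e.hom ≫ biprod.fst ≫ p, by simpa using hip, hN⟩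

variable [IsIdempotentComplete C]

lemma inAdd_of_id_mem_through [HasFiniteBiproducts C] {T X : C} (h : 𝟙 X ∈ through T X X) :
    InAdd T X := by
  obtain ⟨n, a, b, hab⟩ := exists_fin_sum_of_mem_through h
  obtain ⟨Y, -, -, -, -, e⟩ := exists_complement (biproduct.lift a) (biproduct.desc b)
    (by rw [biproduct.lift_desc, hab])
  exact ⟨n, Y, e⟩

/-- A nonzero retract of an indecomposable object is isomorphic to it. -/
lemma nonempty_iso_of_retract {X A : C} (hA : IsIndecomposable A) (hX : ¬ IsZero X)
    (i : X ⟶ A) (p : A ⟶ X) (h : i ≫ p = 𝟙 X) : Nonempty (X ≅ A) := by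
  obtain ⟨Y, j, q, -, hsum, ⟨e⟩⟩ := exists_complement i p h
  have hY : IsZero Y := (hA.2 X Y ⟨e.symm⟩).resolve_left hX
  rw [hY.eq_of_src j 0, comp_zero, add_zero] at hsum
  exact ⟨⟨i, p, h, hsum⟩⟩

lemma IsIndecomposable.eq_zero_or_eq_id {X : C} (hX : IsIndecomposable X) (e : X ⟶ X)
    (he : e ≫ e = e) : e = 0 ∨ e = 𝟙 X := by
  obtain ⟨Y, i, p, hip, hpi⟩ := IsIdempotentComplete.idempotents_split X e he
  obtain ⟨Z, j, q, -, hsum, ⟨φ⟩⟩ := exists_complement i p hip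
  rcases hX.2 Y Z ⟨φ.symm⟩ with hY | hZ
  · left
    rw [← hpi, hY.eq_of_src i 0, comp_zero]
  · right
    rwa [hZ.eq_of_src j 0, comp_zero, add_zero, hpi] at hsum

variable (k : Type*) [Field k] [Linear k C]

/-- Endomorphism algebras of indecomposable objects are local. -/
lemma IsIndecomposable.isIso_or_isIso_of_add {X : C} [FiniteDimensional k (X ⟶ X)]
    (hX : IsIndecomposable X) (a b : X ⟶ X) (hab : IsIso (a + b)) : IsIso a ∨ IsIso b := by
  have : FiniteDimensional k (End X) := inferInstanceAs (FiniteDimensional k (X ⟶ X))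
  have key := isUnit_or_isUnit_one_sub_of_idempotents (k := k) (A := End X)
    (fun e he => hX.eq_zero_or_eq_id e he) (a ≫ inv (a + b) : X ⟶ X)
  have hb : (1 : End X) - (show End X from a ≫ inv (a + b)) = (b ≫ inv (a + b) : X ⟶ X) := by
    change 𝟙 X - a ≫ inv (a + b) = b ≫ inv (a + b)
    rw [sub_eq_iff_eq_add', ← Preadditive.add_comp, IsIso.hom_inv_id]
  rw [hb, isUnit_iff_isIso, isUnit_iff_isIso] at key
  rcases key with h | h
  · left
    have := IsIso.comp_isIso (f := a ≫ inv (a + b)) (h := a + b)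
    rwa [Category.assoc, IsIso.inv_hom_id, Category.comp_id] at this
  · right
    have := IsIso.comp_isIso (f := b ≫ inv (a + b)) (h := a + b)
    rwa [Category.assoc, IsIso.inv_hom_id, Category.comp_id] at this

/-- An indecomposable object in `add (A ⊞ B)` is a retract of `A` or of `B`. -/
lemma IsIndecomposable.retract_or_retract {X A B : C} [FiniteDimensional k (X ⟶ X)]
    (hX : IsIndecomposable X) (h : 𝟙 X ∈ through (A ⊞ B) X X) :
    (∃ (i : X ⟶ A) (p : A ⟶ X), i ≫ p = 𝟙 X) ∨ (∃ (i : X ⟶ B) (p : B ⟶ X), i ≫ p = 𝟙 X) := by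
  refine through_biprod_induction (P := fun f => IsIso f → (∃ (i : X ⟶ A) (p : A ⟶ X), i ≫ p = 𝟙 X) ∨
    (∃ (i : X ⟶ B) (p : B ⟶ X), i ≫ p = 𝟙 X)) ?_ ?_ ?_ ?_ h inferInstance
  · intro a b hab
    exact Or.inl ⟨a, b ≫ inv (a ≫ b), by rw [← Category.assoc, IsIso.hom_inv_id]⟩
  · intro a b hab
    exact Or.inr ⟨a, b ≫ inv (a ≫ b), by rw [← Category.assoc, IsIso.hom_inv_id]⟩
  · exact fun h => absurd h hX.not_isIso_zero
  · intro f g hf hg hfg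
    exact (hX.isIso_or_isIso_of_add k f g hfg).elim hf hg

/-- An indecomposable object in `add T` is a retract of `T`. -/
lemma IsIndecomposable.retract_of_mem_through {X T : C} [FiniteDimensional k (X ⟶ X)]
    (hX : IsIndecomposable X) (h : 𝟙 X ∈ through T X X) :
    ∃ (i : X ⟶ T) (p : T ⟶ X), i ≫ p = 𝟙 X :=
  (hX.retract_or_retract k (A := T) (B := T)
    (through_trans (inl_mem_through T T) h)).elim id id

/-- An object of `add (P ⊞ Q)` without direct summand `P` lies in `add Q`. -/
lemma id_mem_through_right_of_not_retract (hfd : ∀ X Y : C, FiniteDimensional k (X ⟶ Y))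
    {P Q : C} (hP : IsIndecomposable P) (W : C) (hW : 𝟙 W ∈ through (P ⊞ Q) W W)
    (hW' : ∀ (s : P ⟶ W) (r : W ⟶ P), s ≫ r ≠ 𝟙 P) : 𝟙 W ∈ through Q W W := by
  induction W using indecomposable_induction k hfd with
  | zero W h => rw [h.eq_of_src (𝟙 W) 0]; exact zero_mem _
  | indec W h =>
    rcases h.retract_or_retract k hW with ⟨i, p, hip⟩ | ⟨i, p, hip⟩
    · obtain ⟨e⟩ := nonempty_iso_of_retract hP h.1 i p hip
      exact absurd e.inv_hom_id (hW' _ _)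
    · exact id_mem_through_of_retract i p hip (id_mem_through_self Q)
  | sum X Y Z e hY hZ =>
    have hY' : 𝟙 Y ∈ through Q Y Y := by
      refine hY (id_mem_through_of_retract (biprod.inl ≫ e.inv) (e.hom ≫ biprod.fst)
        (by simp) hW) fun s r hsr => hW' (s ≫ biprod.inl ≫ e.inv) (e.hom ≫ biprod.fst ≫ r) ?_
      simpa using hsr
    have hZ' : 𝟙 Z ∈ through Q Z Z := by
      refine hZ (id_mem_through_of_retract (biprod.inr ≫ e.inv) (e.hom ≫ biprod.snd)
        (by simp) hW) fun s r hsr => hW' (s ≫ biprod.inr ≫ e.inv) (e.hom ≫ biprod.snd ≫ r) ?_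
      simpa using hsr
    exact id_mem_through_of_retract e.hom e.inv e.hom_inv_id (id_biprod_mem_through hY' hZ')

end Local

section Approximation

variable {C : Type u} [Category.{v} C] [Preadditive C]

/-- Morphisms through `A` factor through right `A`-approximations. -/
lemma exists_factor_of_mem_through {A B X Z : C} (g : B ⟶ X)
    (hg : ∀ t : A ⟶ X, ∃ t' : A ⟶ B, t = t' ≫ g) {t : Z ⟶ X} (ht : t ∈ through A Z X) :
    ∃ t' : Z ⟶ B, t = t' ≫ g := by
  induction ht using AddSubmonoid.closure_induction with
  | mem f hf =>
    obtain ⟨a, b, rfl⟩ := hf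
    obtain ⟨t', rfl⟩ := hg b
    exact ⟨a ≫ t', (Category.assoc _ _ _).symm⟩
  | zero => exact ⟨0, zero_comp.symm⟩
  | add f f' _ _ hf hf' =>
    obtain ⟨x, rfl⟩ := hf
    obtain ⟨y, rfl⟩ := hf'
    exact ⟨x + y, (Preadditive.add_comp _ _ _ _ _ _).symm⟩

/-- Morphisms through `A` factor through left `A`-approximations. -/
lemma exists_cofactor_of_mem_through {A B X Z : C} (g : X ⟶ B)
    (hg : ∀ t : X ⟶ A, ∃ t' : B ⟶ A, t = g ≫ t') {t : X ⟶ Z} (ht : t ∈ through A X Z) :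
    ∃ t' : B ⟶ Z, t = g ≫ t' := by
  induction ht using AddSubmonoid.closure_induction with
  | mem f hf =>
    obtain ⟨a, b, rfl⟩ := hf
    obtain ⟨t', rfl⟩ := hg a
    exact ⟨t' ≫ b, Category.assoc _ _ _⟩
  | zero => exact ⟨0, comp_zero.symm⟩
  | add f f' _ _ hf hf' =>
    obtain ⟨x, rfl⟩ := hf
    obtain ⟨y, rfl⟩ := hf'
    exact ⟨x + y, (Preadditive.comp_add _ _ _ _ _ _).symm⟩

variable [HasFiniteBiproducts C] (k : Type*) [Field k] [Linear k C]

lemma exists_right_approximation (A X : C) [FiniteDimensional k (A ⟶ X)] :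
    ∃ (B : C) (g : B ⟶ X), 𝟙 B ∈ through A B B ∧
      ∀ t : A ⟶ X, ∃ t' : A ⟶ B, t = t' ≫ g := by
  let b := Module.finBasis k (A ⟶ X)
  refine ⟨⨁ (fun _ : Fin _ => A), biproduct.desc b, id_biproduct_mem_through A _, fun t =>
    ⟨biproduct.lift fun j => b.repr t j • 𝟙 A, ?_⟩⟩
  rw [biproduct.lift_desc]
  simp [b.sum_repr]

lemma exists_left_approximation (A X : C) [FiniteDimensional k (X ⟶ A)] :
    ∃ (B : C) (g : X ⟶ B), 𝟙 B ∈ through A B B ∧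
      ∀ t : X ⟶ A, ∃ t' : B ⟶ A, t = g ≫ t' := by
  let b := Module.finBasis k (X ⟶ A)
  refine ⟨⨁ (fun _ : Fin _ => A), biproduct.lift b, id_biproduct_mem_through A _, fun t =>
    ⟨biproduct.desc fun j => b.repr t j • 𝟙 A, ?_⟩⟩
  rw [biproduct.lift_desc]
  simp [b.sum_repr]

end Approximation

section ExtVanishing

variable {C : Type u} [Category.{v} C] [Preadditive C] [HasShift C ℤ]

/-- Vanishing of `Hom(X, ΣY)`. -/
def ExtVanish (X Y : C) : Prop := ∀ f : X ⟶ Y⟦(1 : ℤ)⟧, f = 0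

lemma ExtVanish.of_left {A B Y : C} (h : ExtVanish A Y) (hB : 𝟙 B ∈ through A B B) :
    ExtVanish B Y := by
  intro f
  have key : ∀ u ∈ through A B B, u ≫ f = 0 := by
    intro u hu
    induction hu using AddSubmonoid.closure_induction with
    | mem u hu =>
      obtain ⟨a, b, rfl⟩ := hu
      rw [Category.assoc, h (b ≫ f), comp_zero]
    | zero => exact zero_comp
    | add u u' _ _ hu hu' => rw [Preadditive.add_comp, hu, hu', add_zero]
  simpa using key _ hB

lemma ExtVanish.of_right [∀ n : ℤ, (shiftFunctor C n).Additive] {A B X : C} (h : ExtVanish X A)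
    (hB : 𝟙 B ∈ through A B B) : ExtVanish X B := by
  intro f
  have key : ∀ u ∈ through A B B, f ≫ u⟦(1 : ℤ)⟧' = 0 := by
    intro u hu
    induction hu using AddSubmonoid.closure_induction with
    | mem u hu =>
      obtain ⟨a, b, rfl⟩ := hu
      rw [Functor.map_comp, ← Category.assoc, h (f ≫ a⟦(1 : ℤ)⟧'), zero_comp]
    | zero => rw [Functor.map_zero, comp_zero]
    | add u u' _ _ hu hu' => rw [Functor.map_add, Preadditive.comp_add, hu, hu', add_zero]
  simpa using key _ hB

lemma TwoCYStructure.extVanish_symm {k : Type*} [Field k] [Linear k C] (cy : TwoCYStructure k C)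
    {X Y : C} (h : ExtVanish X Y) : ExtVanish Y X := by
  intro f
  refine (cy.bijective Y X).1 (LinearMap.ext fun g => ?_)
  rw [h g, map_zero, map_zero]

variable [HasZeroObject C] [∀ n : ℤ, (shiftFunctor C n).Additive] [Pretriangulated C]

lemma extVanish_biprod {X Y Z : C} (hX : ExtVanish X Z) (hY : ExtVanish Y Z) :
    ExtVanish (X ⊞ Y) Z := by
  intro f
  ext
  · rw [hX (biprod.inl ≫ f), comp_zero]
  · rw [hY (biprod.inr ≫ f), comp_zero]

variable {V B X : C} {f : V ⟶ B} {g : B ⟶ X} {h : X ⟶ V⟦(1 : ℤ)⟧}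

lemma exists_lift_to_cone (hT : Triangle.mk f g h ∈ distTriang C) {Z : C}
    (w : Z ⟶ V⟦(1 : ℤ)⟧) (hw : w ≫ f⟦(1 : ℤ)⟧' = 0) : ∃ x : Z ⟶ X, w = x ≫ h :=
  Triangle.coyoneda_exact₁ _ hT w hw

lemma exists_lift_of_comp_connecting (hT : Triangle.mk f g h ∈ distTriang C) {Z : C}
    (w : Z ⟶ X) (hw : w ≫ h = 0) : ∃ y : Z ⟶ B, w = y ≫ g :=
  Triangle.coyoneda_exact₃ _ hT w hw

lemma exists_desc_shift (hT : Triangle.mk f g h ∈ distTriang C) {Z : C}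
    (u : X ⟶ Z⟦(1 : ℤ)⟧) (hu : g ≫ u = 0) : ∃ w : V ⟶ Z, u = h ≫ w⟦(1 : ℤ)⟧' := by
  obtain ⟨w, hw⟩ : ∃ w : V⟦(1 : ℤ)⟧ ⟶ Z⟦(1 : ℤ)⟧, u = h ≫ w :=
    Triangle.yoneda_exact₃ _ hT u hu
  obtain ⟨w', rfl⟩ := (shiftFunctor C (1 : ℤ)).map_surjective w
  exact ⟨w', hw⟩

lemma exists_extension (hT : Triangle.mk f g h ∈ distTriang C) {Z : C} (m : V ⟶ Z)
    (hm : h ≫ m⟦(1 : ℤ)⟧' = 0) : ∃ n : B ⟶ Z, m = f ≫ n := by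
  obtain ⟨n, hn⟩ : ∃ n : B⟦(1 : ℤ)⟧ ⟶ Z⟦(1 : ℤ)⟧, m⟦(1 : ℤ)⟧' = (-f⟦(1 : ℤ)⟧') ≫ n :=
    Triangle.yoneda_exact₃ _ (rot_of_distTriang _ hT) (m⟦(1 : ℤ)⟧') hm
  obtain ⟨n', rfl⟩ := (shiftFunctor C (1 : ℤ)).map_surjective n
  refine ⟨-n', (shiftFunctor C (1 : ℤ)).map_injective ?_⟩
  rw [hn]
  simp

/-- The cone of a left approximation. -/
lemma extVanish_cone (hT : Triangle.mk f g h ∈ distTriang C) {Z : C} (hB : ExtVanish B Z)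
    (hf : ∀ t : V ⟶ Z, ∃ t' : B ⟶ Z, t = f ≫ t') : ExtVanish X Z := by
  intro u
  obtain ⟨w, rfl⟩ := exists_desc_shift hT u (hB (g ≫ u))
  obtain ⟨t, rfl⟩ := hf w
  have h₀ : h ≫ f⟦(1 : ℤ)⟧' = 0 := comp_distTriang_mor_zero₃₁ _ hT
  rw [Functor.map_comp, reassoc_of% h₀, zero_comp]

/-- The cocone of a right approximation. -/
lemma extVanish_cocone (hT : Triangle.mk f g h ∈ distTriang C) {Z : C} (hB : ExtVanish Z B)
    (hg : ∀ t : Z ⟶ X, ∃ t' : Z ⟶ B, t = t' ≫ g) : ExtVanish Z V := by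
  intro u
  obtain ⟨w, rfl⟩ := exists_lift_to_cone hT u (hB _)
  obtain ⟨t, rfl⟩ := hg w
  have h₀ : g ≫ h = 0 := comp_distTriang_mor_zero₂₃ _ hT
  rw [Category.assoc, h₀, comp_zero]

/-- If the connecting morphism of a triangle vanishes, the second morphism splits. -/
lemma exists_section_of_extVanish (hT : Triangle.mk f g h ∈ distTriang C) (hX : ExtVanish X V) :
    ∃ s : X ⟶ B, s ≫ g = 𝟙 X := by
  obtain ⟨s, hs⟩ := exists_lift_of_comp_connecting hT (𝟙 X) (by rw [hX h, comp_zero])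
  exact ⟨s, hs.symm⟩

/-- The comparison of two `Q`-exchange triangles: if the source `V` lies in `add (V' ⊞ Q)`, then
the cone `X` lies in `add (X' ⊞ Q)`. -/
lemma id_mem_through_cone {V' B' X' Q : C} {f' : V' ⟶ B'} {g' : B' ⟶ X'} {h' : X' ⟶ V'⟦(1 : ℤ)⟧}
    (hT : Triangle.mk f g h ∈ distTriang C) (hT' : Triangle.mk f' g' h' ∈ distTriang C)
    (hB : 𝟙 B ∈ through Q B B) (hB' : 𝟙 B' ∈ through Q B' B')
    (hX : ExtVanish X Q) (hX' : ExtVanish X' Q) (hV : 𝟙 V ∈ through (V' ⊞ Q) V V) :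
    𝟙 X ∈ through (X' ⊞ Q) X X := by
  have lift (u : V ⟶ V) (hu : u ∈ through (V' ⊞ Q) V V) :
      ∃ x ∈ through (X' ⊞ Q) X X, x ≫ h = h ≫ u⟦(1 : ℤ)⟧' := by
    refine through_biprod_induction (P := fun u => ∃ x ∈ through (X' ⊞ Q) X X,
      x ≫ h = h ≫ u⟦(1 : ℤ)⟧') ?_ ?_ ?_ ?_ hu
    · intro a b
      obtain ⟨x, hx⟩ := exists_lift_to_cone hT' (h ≫ a⟦(1 : ℤ)⟧')
        (hX.of_right hB' _)
      obtain ⟨y, hy⟩ := exists_lift_to_cone hT (h' ≫ b⟦(1 : ℤ)⟧')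
        (hX'.of_right hB _)
      refine ⟨x ≫ y, through_trans (inl_mem_through _ _) (comp_mem_through x y), ?_⟩
      rw [Category.assoc, ← hy, ← Category.assoc, ← hx, Functor.map_comp, Category.assoc]
    · intro a b
      exact ⟨0, zero_mem _, by
        rw [Functor.map_comp, ← Category.assoc, hX (h ≫ a⟦(1 : ℤ)⟧'), zero_comp, zero_comp]⟩
    · exact ⟨0, zero_mem _, by rw [Functor.map_zero, comp_zero, zero_comp]⟩
    · rintro u w ⟨x, hx, hxu⟩ ⟨y, hy, hyw⟩
      exact ⟨x + y, add_mem hx hy, by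
        rw [Functor.map_add, Preadditive.add_comp, Preadditive.comp_add, hxu, hyw]⟩
  obtain ⟨x, hx, hxh⟩ := lift _ hV
  rw [CategoryTheory.Functor.map_id, Category.comp_id] at hxh
  obtain ⟨y, hy⟩ := exists_lift_of_comp_connecting hT (𝟙 X - x) (by
    rw [Preadditive.sub_comp, hxh, Category.id_comp, sub_self])
  rw [← add_sub_cancel x (𝟙 X), hy]
  exact add_mem hx (through_trans (inr_mem_through _ _)
    (through_trans hB (comp_mem_through y g)))

end ExtVanishing

section Exchange

variable (k : Type*) [Field k] {C : Type u} [Category.{v} C] [Preadditive C] [Linear k C]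
  [HasZeroObject C] [HasShift C ℤ] [∀ n : ℤ, (shiftFunctor C n).Additive] [Pretriangulated C]
  [HasFiniteBiproducts C]

/-- An object `X` all of whose morphisms from `P` factor through `Q` is the
cone of a morphism from `add (P ⊞ Q)` to `add Q`. -/
lemma exists_triangle_of_mem_through (hfd : ∀ X Y : C, FiniteDimensional k (X ⟶ Y)) {P Q : C}
    (hR : ∀ X : C, ExtVanish (P ⊞ Q) X → 𝟙 X ∈ through (P ⊞ Q) X X)
    (hRR : ExtVanish (P ⊞ Q) (P ⊞ Q)) {X : C}
    (hPX : ∀ t : P ⟶ X, t ∈ through Q P X) :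
    ∃ (V B : C) (f : V ⟶ B) (g : B ⟶ X) (h : X ⟶ V⟦(1 : ℤ)⟧),
      Triangle.mk f g h ∈ distTriang C ∧ 𝟙 B ∈ through Q B B ∧ 𝟙 V ∈ through (P ⊞ Q) V V := by
  obtain ⟨B, g, hB, hg⟩ := exists_right_approximation k Q X
  obtain ⟨V, f, h, hT⟩ := distinguished_cocone_triangle₁ g
  refine ⟨V, B, f, g, h, hT, hB, hR V ?_⟩
  have hRB : ExtVanish (P ⊞ Q) B :=
    (hRR.of_right (inr_mem_through P Q)).of_right hB
  exact extVanish_biprod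
    (extVanish_cocone hT (hRB.of_left (inl_mem_through P Q))
      fun t => exists_factor_of_mem_through g hg (hPX t))
    (extVanish_cocone hT (hRB.of_left (inr_mem_through P Q)) hg)

variable [IsIdempotentComplete C]

/-- A right `R`-approximation whose source is minimal with respect to the summand `P`. -/
lemma exists_minimal_right_approximation (hfd : ∀ X Y : C, FiniteDimensional k (X ⟶ Y))
    {P : C} (hP : ¬ IsZero P) (R Y : C) :
    ∃ (W : C) (g : W ⟶ Y), 𝟙 W ∈ through R W W ∧ (∀ t : R ⟶ Y, ∃ t' : R ⟶ W, t = t' ≫ g) ∧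
      ∀ s : P ⟶ W, s ≫ g = 0 → ∀ p : W ⟶ P, s ≫ p ≠ 𝟙 P := by
  have key : ∀ (n : ℕ) (W : C) (g : W ⟶ Y), Module.finrank k (W ⟶ W) = n →
      𝟙 W ∈ through R W W → (∀ t : R ⟶ Y, ∃ t' : R ⟶ W, t = t' ≫ g) →
      ∃ (W : C) (g : W ⟶ Y), 𝟙 W ∈ through R W W ∧ (∀ t : R ⟶ Y, ∃ t' : R ⟶ W, t = t' ≫ g) ∧
        ∀ s : P ⟶ W, s ≫ g = 0 → ∀ p : W ⟶ P, s ≫ p ≠ 𝟙 P := by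
    intro n
    induction n using Nat.strong_induction_on with
    | _ n ih =>
      intro W g hn hW hg
      by_cases hmin : ∀ s : P ⟶ W, s ≫ g = 0 → ∀ p : W ⟶ P, s ≫ p ≠ 𝟙 P
      · exact ⟨W, g, hW, hg, hmin⟩
      push Not at hmin
      obtain ⟨s, hs, p, hsp⟩ := hmin
      obtain ⟨W', j, q, hjq, hsum, -⟩ := exists_complement s p hsp
      have hqj : q ≫ j ≠ 𝟙 W := by
        intro h
        rw [h, add_eq_right] at hsum
        refine hP ((IsZero.iff_id_eq_zero P).2 ?_)
        have := congrArg (fun t => s ≫ t ≫ p) hsum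
        simpa [hsp, reassoc_of% hsp] using this
      have hg' : q ≫ j ≫ g = g := by
        have := congrArg (· ≫ g) hsum
        simpa [hs] using this
      refine ih _ ?_ W' (j ≫ g) rfl (id_mem_through_of_retract j q hjq hW) fun t => ?_
      · rw [← hn]
        exact finrank_end_lt_of_retract k j q hjq hqj
      · obtain ⟨t', rfl⟩ := hg t
        exact ⟨t' ≫ q, by rw [Category.assoc, hg']⟩
  obtain ⟨W, g, hW, hg⟩ := exists_right_approximation k R Y
  exact key _ W g rfl hW hg

/-- If `Y` is an indecomposable rigid object outside `add (P ⊞ Q)` with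
`Hom(Y, ΣQ) = 0`, every morphism from `P` to `Y` factors through `add Q`. -/
lemma mem_through_of_rigid (hfd : ∀ X Y : C, FiniteDimensional k (X ⟶ Y)) {P Q : C}
    (hR : ∀ X : C, ExtVanish (P ⊞ Q) X → 𝟙 X ∈ through (P ⊞ Q) X X)
    (hRR : ExtVanish (P ⊞ Q) (P ⊞ Q))
    (hP : IsIndecomposable P) {Y : C} (hY : 𝟙 Y ∉ through (P ⊞ Q) Y Y) (hYY : ExtVanish Y Y)
    (hYQ : ExtVanish Y Q) (t : P ⟶ Y) : t ∈ through Q P Y := by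
  obtain ⟨W, g, hW, hg, hmin⟩ := exists_minimal_right_approximation k hfd hP.1 (P ⊞ Q) Y
  obtain ⟨V, f, h, hT⟩ := distinguished_cocone_triangle₁ g
  have hV : 𝟙 V ∈ through (P ⊞ Q) V V := hR V (extVanish_cocone hT (hRR.of_right hW) hg)
  by_cases hVP : ∀ (s : P ⟶ V) (r : V ⟶ P), s ≫ r ≠ 𝟙 P
  · have hVQ := id_mem_through_right_of_not_retract k hfd hP V hV hVP
    obtain ⟨s, hs⟩ := exists_section_of_extVanish hT (hYQ.of_right hVQ)
    exact absurd (id_mem_through_of_retract s g hs hW) hY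
  by_cases hWP : ∀ (i : P ⟶ W) (p : W ⟶ P), i ≫ p ≠ 𝟙 P
  · have hWQ := id_mem_through_right_of_not_retract k hfd hP W hW hWP
    have ht : t ∈ through (P ⊞ Q) P Y := by
      simpa using through_comp_right (inl_mem_through P Q) t
    obtain ⟨t', rfl⟩ := exists_factor_of_mem_through g hg ht
    exact through_trans hWQ (comp_mem_through t' g)
  push Not at hVP hWP
  obtain ⟨s, r, hsr⟩ := hVP
  obtain ⟨i, p, hip⟩ := hWP
  have hfg : f ≫ g = 0 := comp_distTriang_mor_zero₁₂ _ hT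
  obtain ⟨ψ', hψ'⟩ := exists_extension hT ((r ≫ i) ≫ g) (hYY _)
  have hψ'' : ψ' ∈ through (P ⊞ Q) W Y := by
    simpa using through_comp_right hW ψ'
  obtain ⟨ψ, rfl⟩ := exists_factor_of_mem_through g hg hψ''
  obtain ⟨χ, hχ⟩ : ∃ χ : V ⟶ V, r ≫ i - f ≫ ψ = χ ≫ f :=
    Triangle.coyoneda_exact₂ _ hT (r ≫ i - f ≫ ψ) (by
      change (r ≫ i - f ≫ ψ) ≫ g = 0
      rw [Preadditive.sub_comp, hψ', Category.assoc, sub_self])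
  have hno (a : P ⟶ V) (b : W ⟶ P) : ¬ IsIso ((a ≫ f) ≫ b) := fun hab =>
    hmin (a ≫ f) (by rw [Category.assoc, hfg, comp_zero]) (b ≫ inv ((a ≫ f) ≫ b))
      (by rw [← Category.assoc, IsIso.hom_inv_id])
  have hone : (s ≫ f) ≫ (ψ ≫ p) + ((s ≫ χ) ≫ f) ≫ p = 𝟙 P := by
    have : s ≫ (f ≫ ψ + χ ≫ f) ≫ p = 𝟙 P := by
      rw [← hχ, add_sub_cancel, Category.assoc, reassoc_of% hsr, hip]
    simpa using this
  have hiso : IsIso ((s ≫ f) ≫ (ψ ≫ p) + ((s ≫ χ) ≫ f) ≫ p) := by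
    rw [hone]
    infer_instance
  exact ((hP.isIso_or_isIso_of_add k _ _ hiso).elim (hno s (ψ ≫ p)) (hno (s ≫ χ) p)).elim

end Exchange

theorem mutation_of_cluster_tilting
    (k : Type*) [Field k]
    (C : Type u) [Category.{v} C] [Preadditive C] [Linear k C] [HasZeroObject C]
    [HasShift C ℤ] [∀ n : ℤ, (shiftFunctor C n).Additive] [Pretriangulated C]
    [HasFiniteBiproducts C] [IsIdempotentComplete C]
    (hfd : ∀ X Y : C, FiniteDimensional k (X ⟶ Y))
    (cy : TwoCYStructure k C)
    (Ri Rbar : C)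
    (hind : IsIndecomposable Ri)
    (hct : IsClusterTilting (Ri ⊞ Rbar))
    (hbasic : IsBasic (Ri ⊞ Rbar)) :
    ∃ Ristar : C,
      IsIndecomposable Ristar ∧
      IsEmpty (Ristar ≅ Ri) ∧
      IsClusterTilting (Ristar ⊞ Rbar) ∧
      ∀ Y : C, IsIndecomposable Y → IsClusterTilting (Y ⊞ Rbar) →
        (Nonempty (Y ≅ Ri) ∨ Nonempty (Y ≅ Ristar)) := by
  have hR : ∀ X : C, ExtVanish (Ri ⊞ Rbar) X → 𝟙 X ∈ through (Ri ⊞ Rbar) X X :=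
    fun X hX => (hct.2 X hX).id_mem_through
  have hRR : ExtVanish (Ri ⊞ Rbar) (Ri ⊞ Rbar) := hct.1
  have hRQ : ExtVanish (Ri ⊞ Rbar) Rbar := hRR.of_right (inr_mem_through _ _)
  have hQR : ExtVanish Rbar (Ri ⊞ Rbar) := hRR.of_left (inr_mem_through _ _)
  have hQP : ExtVanish Rbar Ri := hQR.of_right (inl_mem_through _ _)
  have hQQ : ExtVanish Rbar Rbar := hQR.of_right (inr_mem_through _ _)
  have hPP : ExtVanish Ri Ri :=
    (hRR.of_right (inl_mem_through _ _)).of_left (inl_mem_through _ _)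
  have hP : 𝟙 Ri ∉ through Rbar Ri Ri := by
    intro h
    obtain ⟨i, p, hip⟩ := hind.retract_of_mem_through k h
    obtain ⟨W, -, -, -, -, ⟨e⟩⟩ := exists_complement i p hip
    exact hbasic Ri hind ⟨W, ⟨biprod.mapIso (Iso.refl Ri) e.symm ≪≫
      (biprod.associator Ri Ri W).symm⟩⟩
  obtain ⟨B, f, hB, hf⟩ := exists_left_approximation k Rbar Ri
  obtain ⟨M, g, h, hT⟩ := distinguished_cocone_triangle f
  have hMQ : ExtVanish M Rbar := extVanish_cone hT (hQQ.of_left hB) hf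
  have hQM : ExtVanish Rbar M := cy.extVanish_symm hMQ
  have hfac (t : Ri ⟶ B) : ∃ t' : B ⟶ B, t = f ≫ t' :=
    exists_cofactor_of_mem_through f hf (by simpa using through_comp_left t hB)
  have hMM : ExtVanish M M := by
    refine extVanish_cone hT (hQM.of_left hB) fun t => ?_
    obtain ⟨l, rfl⟩ := exists_lift_of_comp_connecting hT t (hPP _)
    obtain ⟨m, rfl⟩ := hfac l
    exact ⟨m ≫ g, Category.assoc _ _ _⟩
  have hPX {X : C} (hX : ExtVanish M X) (t : Ri ⟶ X) : t ∈ through Rbar Ri X := by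
    obtain ⟨n, rfl⟩ := exists_extension hT t (hX _)
    exact through_trans hB (comp_mem_through f n)
  have hM : 𝟙 M ∉ through Rbar M M := by
    intro hM
    refine hP ?_
    simpa using hPX ((hQP.of_left hM)) (𝟙 Ri)
  have exchange {X : C} (hXQ : ExtVanish X Rbar) (hX : ∀ t : Ri ⟶ X, t ∈ through Rbar Ri X) :
      𝟙 X ∈ through (M ⊞ Rbar) X X := by
    obtain ⟨V, B', f', g', h', hT', hB', hV⟩ := exists_triangle_of_mem_through k hfd hR hRR hX
    exact id_mem_through_cone hT' hT hB' hB hXQ hMQ hV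
  obtain ⟨N, i, p, hip, hN, hNQ'⟩ := exists_indecomposable_retract k hfd M hM
  have hNM : 𝟙 N ∈ through M N N := id_mem_through_of_retract i p hip (id_mem_through_self M)
  have hNQ : ExtVanish N Rbar := hMQ.of_left hNM
  have hMN : ExtVanish M N := hMM.of_right hNM
  obtain ⟨V, B', f', g', h', hT', hB', hV⟩ :=
    exists_triangle_of_mem_through k hfd hR hRR (hPX hMN)
  have hNV : ¬ ExtVanish N V := by
    intro hNV
    obtain ⟨s, hs⟩ := exists_section_of_extVanish hT' hNV
    exact hNQ' (id_mem_through_of_retract s g' hs hB')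
  have hMNQ : 𝟙 M ∈ through (N ⊞ Rbar) M M := by
    refine id_mem_through_cone hT hT' hB hB' hMQ hNQ ?_
    by_contra hcon
    refine hNV (hNQ.of_right (id_mem_through_right_of_not_retract k hfd hind V hV
      fun s r hsr => hcon ?_))
    exact through_trans (inl_mem_through V Rbar) (hsr ▸ comp_mem_through s r)
  have hMQN : 𝟙 (M ⊞ Rbar) ∈ through (N ⊞ Rbar) (M ⊞ Rbar) (M ⊞ Rbar) :=
    id_biprod_mem_through hMNQ (inr_mem_through _ _)
  have hNPiso : IsEmpty (N ≅ Ri) := by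
    refine ⟨fun e => hNV (ExtVanish.of_right (A := Ri ⊞ Rbar) ?_ hV)⟩
    exact (hRR.of_left (inl_mem_through _ _)).of_left
      (id_mem_through_of_retract e.hom e.inv e.hom_inv_id (id_mem_through_self Ri))
  refine ⟨N, hN, hNPiso, ⟨?_, fun X hX => inAdd_of_id_mem_through ?_⟩, fun Y hY hYct => ?_⟩
  · have hQN : ExtVanish Rbar N := hQM.of_right hNM
    exact extVanish_biprod
      (cy.extVanish_symm (extVanish_biprod (hMN.of_left hNM) hQN))
      (cy.extVanish_symm (extVanish_biprod hNQ hQQ))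
  · have hX' : ExtVanish (M ⊞ Rbar) X := ExtVanish.of_left (A := N ⊞ Rbar) hX hMQN
    exact through_trans hMQN (exchange
      (cy.extVanish_symm (hX'.of_left (inr_mem_through _ _)))
      (hPX (hX'.of_left (inl_mem_through _ _))))
  · have hYR : ExtVanish (Y ⊞ Rbar) (Y ⊞ Rbar) := hYct.1
    have hYQ : ExtVanish Y Rbar :=
      (hYR.of_left (inl_mem_through _ _)).of_right (inr_mem_through _ _)
    have hYY : ExtVanish Y Y :=
      (hYR.of_left (inl_mem_through _ _)).of_right (inl_mem_through _ _)
    have hY' : 𝟙 Y ∉ through Rbar Y Y := by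
      intro h
      have := (hYct.2 Ri (extVanish_biprod (hQP.of_left h) hQP)).id_mem_through
      exact hP (through_trans (id_biprod_mem_through h (id_mem_through_self _)) this)
    have hYQ_retract (a : Y ⟶ Rbar) (b : Rbar ⟶ Y) (hab : a ≫ b = 𝟙 Y) : False :=
      hY' (hab ▸ comp_mem_through a b)
    by_cases hYR' : 𝟙 Y ∈ through (Ri ⊞ Rbar) Y Y
    · rcases hY.retract_or_retract k hYR' with ⟨a, b, hab⟩ | ⟨a, b, hab⟩
      · exact Or.inl (nonempty_iso_of_retract hind hY.1 a b hab)
      · exact (hYQ_retract a b hab).elim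
    · have hYN := through_trans hMQN
        (exchange hYQ (mem_through_of_rigid k hfd hR hRR hind hYR' hYY hYQ))
      rcases hY.retract_or_retract k hYN with ⟨a, b, hab⟩ | ⟨a, b, hab⟩
      · exact Or.inr (nonempty_iso_of_retract hN hY.1 a b hab)
      · exact (hYQ_retract a b hab).elim
end

section
/- Let k be a field and A a finite-dimensional hereditary k-algebra, i.e., every A-submodule of a projective A-module is projective (equivalently, Ext²_A(M,N) = 0 for all finite-dimensional A-modules M, N). Then every indecomposable object of the bounded derived category D^b(mod A) of finite-dimensional A-modules is isomorphic to a stalk complex M[i] for some indecomposable finite-dimensional A-module M and some integer i. -/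
/-!
STATEMENT 15 (Happel): Let `k` be a field and `A` a finite-dimensional hereditary
`k`-algebra (every submodule of a projective `A`-module is projective).  Then every
indecomposable object of the bounded derived category `D^b(mod A)` is isomorphic to a
stalk complex `M[i]` for an indecomposable finite-dimensional `A`-module `M` and an
integer `i`.

`D^b(mod A)` is realized inside the derived category of `ModuleCat A` as the objects
whose homology is finite-dimensional and vanishes outside a bounded range; the stalk
complex `M[i]` is `(DerivedCategory.singleFunctor _ i).obj M`.
-/

open CategoryTheory Limits

universe w u

namespace DerivedCategory

universe v u'

variable {C : Type u'} [Category.{v} C] [Abelian C] [HasDerivedCategory.{w} C]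

open Pretriangulated TStructure

lemma hom_from_singleFunctor_obj_projective_eq_zero {P : C} [Projective P]
    {Y : DerivedCategory C} {m n : ℤ} (hmn : m < n) [Y.IsLE m]
    (f : (singleFunctor C n).obj P ⟶ Y) : f = 0 := by
  obtain ⟨L, _, ⟨e⟩⟩ := Y.exists_iso_Q_obj_of_isLE m
  rw [← cancel_mono e.hom, zero_comp]
  exact from_singleFunctor_obj_eq_zero_of_projective (f ≫ e.hom) m hmn

/-- If `M` has a projective resolution of length one, there are no non-zero morphisms from `M` in
degree `n` to objects concentrated in degrees `≤ n - 2`. -/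
lemma hom_from_singleFunctor_obj_eq_zero_of_shortExact {S : ShortComplex C} (hS : S.ShortExact)
    [Projective S.X₁] [Projective S.X₂] {Y : DerivedCategory C} {m n : ℤ} (hmn : m + 1 < n)
    [Y.IsLE m] (f : (singleFunctor C n).obj S.X₃ ⟶ Y) : f = 0 := by
  have hT := triangleOfSES_distinguished
    (hS.map_of_exact (HomologicalComplex.single C (ComplexShape.up ℤ) n))
  obtain ⟨g, rfl⟩ := Triangle.yoneda_exact₃ _ hT f
    (hom_from_singleFunctor_obj_projective_eq_zero (m := m) (n := n) (P := S.X₂) (by lia) _)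
  obtain ⟨g', hg'⟩ := (shiftFunctor (DerivedCategory C) (1 : ℤ)).map_surjective
    (g ≫ (shiftNegShift Y (1 : ℤ)).inv)
  have : (Y⟦(-1 : ℤ)⟧).IsLE (m + 1) :=
    t.isLE_shift Y m (-1) (m + 1)
  have hg₀ : g' = 0 :=
    hom_from_singleFunctor_obj_projective_eq_zero (m := m + 1) (n := n) (P := S.X₁) hmn g'
  rw [hg₀, Functor.map_zero] at hg'
  rw [zero_of_comp_mono _ hg'.symm]
  exact comp_zero

lemma isLE_obj₃ {T : Triangle (DerivedCategory C)} (hT : T ∈ distTriang _) (n : ℤ)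
    (h₁ : T.obj₁.IsLE (n + 1)) (h₂ : T.obj₂.IsLE n) : T.obj₃.IsLE n := by
  rw [isLE_iff] at *
  exact fun i hi ↦ (HomologySequence.exact₃ T hT i (i + 1) rfl).isZero_of_both_zeros
    ((h₂ i hi).eq_of_src _ _) ((h₁ (i + 1) (by lia)).eq_of_tgt _ _)

/-- In an abelian category where every object has a projective resolution of length one, the
truncation triangle of `X` at its top degree `n` splits. -/
lemma exists_iso_biprod_singleFunctor_obj
    (hC : ∀ M : C, ∃ (S : ShortComplex C) (_ : S.ShortExact),
      Projective S.X₁ ∧ Projective S.X₂ ∧ S.X₃ = M)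
    (X : DerivedCategory C) (n : ℤ) [X.IsLE n] :
    ∃ (Y : DerivedCategory C) (M : C), Y.IsLE (n - 1) ∧
      Nonempty (X ≅ Y ⊞ (singleFunctor C n).obj M) := by
  obtain ⟨Y, Z, hY, hZ, f, g, h, hT⟩ := t.exists_triangle X (n - 1) n (by lia)
  have hY : Y.IsLE (n - 1) := ⟨hY⟩
  have : Z.IsGE n := ⟨hZ⟩
  have : Z.IsLE n := isLE_obj₃ hT n (t.isLE_of_le Y (n - 1) (n + 1)) ‹_›
  obtain ⟨M, ⟨e⟩⟩ := Z.exists_iso_singleFunctor_obj_of_isGE_of_isLE n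
  have : h = 0 := by
    obtain ⟨S, hS, _, _, rfl⟩ := hC M
    have : (Y⟦(1 : ℤ)⟧).IsLE (n - 2) := t.isLE_shift Y (n - 1) 1 (n - 2)
    rw [← cancel_epi e.inv, comp_zero]
    exact hom_from_singleFunctor_obj_eq_zero_of_shortExact hS (m := n - 2) (by lia) _
  obtain ⟨e', -⟩ := exists_iso_binaryBiproduct_of_distTriang _ hT this
  exact ⟨Y, M, hY, ⟨e' ≪≫ biprod.mapIso (Iso.refl Y) e⟩⟩

lemma isZero_of_isZero_homology (X : DerivedCategory C)
    (hX : ∀ n, IsZero ((homologyFunctor C n).obj X)) : IsZero X := by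
  have : X.IsLE 0 := (isLE_iff _ _).2 fun n _ ↦ hX n
  have : X.IsGE 1 := (isGE_iff _ _).2 fun n _ ↦ hX n
  exact t.isZero X 0 1

/-- An indecomposable bounded above object is a stalk complex. -/
lemma exists_iso_singleFunctor_obj_of_indecomposable
    (hC : ∀ M : C, ∃ (S : ShortComplex C) (_ : S.ShortExact),
      Projective S.X₁ ∧ Projective S.X₂ ∧ S.X₃ = M)
    (X : DerivedCategory C) (hX : ∃ b, X.IsLE b) (hX₀ : ¬ IsZero X)
    (hXind : ∀ Y Z : DerivedCategory C, Nonempty (X ≅ Y ⊞ Z) → IsZero Y ∨ IsZero Z) :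
    ∃ (M : C) (n : ℤ), Nonempty (X ≅ (singleFunctor C n).obj M) := by
  obtain ⟨b, hb⟩ := hX
  obtain ⟨n, hn, hn'⟩ : ∃ n, ¬ IsZero ((homologyFunctor C n).obj X) ∧
      ∀ m, ¬ IsZero ((homologyFunctor C m).obj X) → m ≤ n := by
    refine Int.exists_greatest_of_bdd ⟨b, fun m hm ↦ ?_⟩ ?_
    · by_contra! h
      exact hm (isZero_of_isLE X b m h)
    · by_contra! h
      exact hX₀ (isZero_of_isZero_homology X h)
  have : X.IsLE n := (isLE_iff _ _).2 fun m hm ↦ by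
    by_contra h
    exact (hn' m h).not_gt hm
  obtain ⟨Y, M, hY, ⟨e⟩⟩ := exists_iso_biprod_singleFunctor_obj hC X n
  obtain h | h := hXind _ _ ⟨e⟩
  · exact ⟨M, n, ⟨e ≪≫ (isoZeroBiprod h).symm⟩⟩
  · exact (hn ((isZero_of_isLE Y (n - 1) n (by lia)).of_iso
      ((homologyFunctor C n).mapIso (e ≪≫ (isoBiprodZero h).symm)))).elim

end DerivedCategory

namespace ModuleCat

variable {A : Type u} [Ring A]

lemma exists_shortExact_projective_of_hereditary
    (hA : ∀ (M : Type u) [AddCommGroup M] [Module A M],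
      Module.Projective A M → ∀ N : Submodule A M, Module.Projective A N)
    (M : ModuleCat.{u} A) :
    ∃ (S : ShortComplex (ModuleCat.{u} A)) (_ : S.ShortExact),
      Projective S.X₁ ∧ Projective S.X₂ ∧ S.X₃ = M := by
  let p := Projective.π M
  have hK : Module.Projective A (kernel p : ModuleCat.{u} A) :=
    have := hA _ (projective_of_module_projective (Projective.over M))
      (LinearMap.range (kernel.ι p).hom)
    .of_equiv (LinearEquiv.ofInjective (kernel.ι p).hom
      ((ModuleCat.mono_iff_injective _).1 inferInstance)).symm
  exact ⟨.mk _ _ (kernel.condition p), { exact := ShortComplex.exact_kernel p },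
    projective_of_categoryTheory_projective _, Projective.projective_over M, rfl⟩

/-- A module decomposes as the biproduct of two complementary submodules. -/
noncomputable def isoBiprodOfIsCompl {M : ModuleCat.{u} A} {S T : Submodule A M}
    (h : IsCompl S T) : M ≅ ModuleCat.of A S ⊞ ModuleCat.of A T :=
  (Submodule.prodEquivOfIsCompl S T h).symm.toModuleIso ≪≫
    (biprodIsoProd (ModuleCat.of A S) (ModuleCat.of A T)).symm

end ModuleCat

theorem hereditary_indecomposable_in_derived_category_is_stalk
    (k : Type u) [Field k] (A : Type u) [Ring A] [Algebra k A] [FiniteDimensional k A]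
    -- `A` is hereditary: submodules of projective modules are projective
    (hhered : ∀ (M : Type u) [AddCommGroup M] [Module A M],
      Module.Projective A M → ∀ N : Submodule A M, Module.Projective A N)
    [HasDerivedCategory.{w} (ModuleCat.{u} A)]
    (X : DerivedCategory (ModuleCat.{u} A))
    -- `X` lies in `D^b(mod A)`: its homology is bounded ...
    (hbounded : ∃ a b : ℤ, ∀ n : ℤ, (n < a ∨ b < n) →
      IsZero ((DerivedCategory.homologyFunctor (ModuleCat.{u} A) n).obj X))
    -- ... and finite-dimensional (equivalently, finite over `A`) in each degree
    (hfd : ∀ n : ℤ,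
      Module.Finite A ((DerivedCategory.homologyFunctor (ModuleCat.{u} A) n).obj X))
    -- `X` is indecomposable: non-zero, and not a direct sum of two non-zero objects
    (hXne : ¬ IsZero X)
    (hXind : ∀ (Y Z : DerivedCategory (ModuleCat.{u} A)),
      Nonempty (X ≅ Y ⊞ Z) → IsZero Y ∨ IsZero Z) :
    ∃ (M : ModuleCat.{u} A) (i : ℤ),
      Module.Finite A M ∧
      -- `M` is an indecomposable module
      Nontrivial M ∧ (∀ S T : Submodule A M, IsCompl S T → S = ⊥ ∨ T = ⊥) ∧
      Nonempty (X ≅ (DerivedCategory.singleFunctor (ModuleCat.{u} A) i).obj M) := by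
  obtain ⟨_, b, hb⟩ := hbounded
  obtain ⟨M, n, ⟨e⟩⟩ := DerivedCategory.exists_iso_singleFunctor_obj_of_indecomposable
    (ModuleCat.exists_shortExact_projective_of_hereditary hhered) X
    ⟨b, (DerivedCategory.isLE_iff _ _).2 fun m hm ↦ hb m (Or.inr hm)⟩ hXne hXind
  let F := DerivedCategory.singleFunctor (ModuleCat.{u} A) n
  have isZero_of_map {N : ModuleCat.{u} A} (h : IsZero (F.obj N)) : IsZero N :=
    (IsZero.iff_id_eq_zero N).2 (F.map_injective (h.eq_of_src _ _))
  refine ⟨M, n, ?_, ?_, fun S T hST ↦ ?_, ⟨e⟩⟩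
  · have := hfd n
    exact .equiv ((DerivedCategory.homologyFunctor _ n).mapIso e ≪≫
      (DerivedCategory.singleFunctorCompHomologyFunctorIso _ n).app M).toLinearEquiv
  · by_contra h
    rw [not_nontrivial_iff_subsingleton] at h
    exact hXne ((F.map_isZero (ModuleCat.isZero_of_subsingleton M)).of_iso e)
  · have := preservesBinaryBiproducts_of_preservesBiproducts F
    have e' : X ≅ F.obj (ModuleCat.of A S) ⊞ F.obj (ModuleCat.of A T) :=
      e ≪≫ F.mapIso (ModuleCat.isoBiprodOfIsCompl hST) ≪≫ F.mapBiprod _ _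
    refine (hXind _ _ ⟨e'⟩).imp (fun h ↦ ?_) fun h ↦ ?_ <;>
    · have := ModuleCat.subsingleton_of_isZero (isZero_of_map h)
      exact Submodule.subsingleton_iff_eq_bot.1 this
end
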